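/- For an odd primitive Dirichlet character χ mod an odd prime q, L'(0,χ) = -(log q)·L(0,χ) + Σ_{a=1}^{q-1} χ(a) log Γ(a/q). -/

import Mathlib

open Finset Real

open Filter Topology HurwitzZeta

theorem norm_sub_sub_smul_deriv_le {E : Type*} [NormedAddCommGroup E] [NormedSpace ℝ E]
    {f df ddf : ℝ → E} {a b M : ℝ}
    (hf : ∀ t ∈ Set.Icc a b, HasDerivAt f (df t) t)
    (hdf : ∀ t ∈ Set.Icc a b, HasDerivAt df (ddf t) t)
    (hM : ∀ t ∈ Set.Icc a b, ‖ddf t‖ ≤ M) {u v : ℝ}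
    (hu : u ∈ Set.Icc a b) (hv : v ∈ Set.Icc a b) :
    ‖f u - f v - (u - v) • df v‖ ≤ M * (b - a) * |u - v| := by
  have hM0 : 0 ≤ M := (norm_nonneg _).trans (hM u hu)
  have hbound : ∀ t ∈ Set.Icc a b, ‖df t - df v‖ ≤ M * (b - a) := fun t ht ↦ by
    refine ((convex_Icc a b).norm_image_sub_le_of_norm_hasDerivWithin_le
      (fun z hz ↦ (hdf z hz).hasDerivWithinAt) hM hv ht).trans ?_
    gcongr
    rw [Real.norm_eq_abs, abs_le]
    constructor <;> linarith [hv.1, hv.2, ht.1, ht.2]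
  have hderiv : ∀ t ∈ Set.Icc a b,
      HasDerivWithinAt (fun t ↦ f t - t • df v) (df t - df v) (Set.Icc a b) t := fun t ht ↦ by
    simpa using ((hf t ht).fun_sub ((hasDerivAt_id t).smul_const (df v))).hasDerivWithinAt
  have h := (convex_Icc a b).norm_image_sub_le_of_norm_hasDerivWithin_le hderiv hbound hv hu
  rw [Real.norm_eq_abs] at h
  convert! h using 2
  module

theorem hasDerivAt_ofReal_cpow_of_pos (r : ℂ) {t : ℝ} (ht : 0 < t) :
    HasDerivAt (fun y : ℝ ↦ (y : ℂ) ^ r) (r * (t : ℂ) ^ (r - 1)) t := by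
  simpa using ((hasDerivAt_id (t : ℂ)).cpow_const (c := r)
    (Complex.ofReal_mem_slitPlane.mpr ht)).comp_ofReal

/-- Up to the telescoping term `(1 - x) * ((n + 1) ^ (-s) - (n + 2) ^ (-s))`, the `n`-th term of the
series for `ζ(s, x) - ζ(s, 1)`. The correction makes the series converge for `-1 < re s`. -/
noncomputable def hurwitzZetaSubTerm (x : ℝ) (n : ℕ) (s : ℂ) : ℂ :=
  ((n + x : ℝ) : ℂ) ^ (-s) - ((n + 1 : ℝ) : ℂ) ^ (-s) -
    (1 - x) * (((n + 1 : ℝ) : ℂ) ^ (-s) - ((n + 2 : ℝ) : ℂ) ^ (-s))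

theorem norm_hurwitzZetaSubTerm_le {x : ℝ} (hx : x ∈ Set.Ioc 0 1) (n : ℕ) {s : ℂ}
    (hs : -1 / 2 < s.re) (hs' : ‖s‖ < 3) :
    ‖hurwitzZetaSubTerm x n s‖ ≤ 48 * x ^ (-5 : ℝ) * ((n + 1 : ℝ) ^ (-(3 / 2) : ℝ)) := by
  obtain ⟨hx0, hx1⟩ := hx
  have hn : (0 : ℝ) ≤ n := n.cast_nonneg
  set M : ℝ := 12 * x ^ (-5 : ℝ) * ((n + 1 : ℝ) ^ (-(3 / 2) : ℝ)) with hM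
  have hpos : ∀ t ∈ Set.Icc (n + x : ℝ) (n + 2), 0 < t := fun t ht ↦ by linarith [ht.1]
  have hf : ∀ t ∈ Set.Icc (n + x : ℝ) (n + 2),
      HasDerivAt (fun y : ℝ ↦ (y : ℂ) ^ (-s)) (-s * (t : ℂ) ^ (-s - 1)) t :=
    fun t ht ↦ hasDerivAt_ofReal_cpow_of_pos _ (hpos t ht)
  have hf' : ∀ t ∈ Set.Icc (n + x : ℝ) (n + 2),
      HasDerivAt (fun y : ℝ ↦ -s * (y : ℂ) ^ (-s - 1))
        (-s * ((-s - 1) * (t : ℂ) ^ (-s - 1 - 1))) t :=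
    fun t ht ↦ (hasDerivAt_ofReal_cpow_of_pos _ (hpos t ht)).const_mul _
  have hre : s.re < 3 := (Complex.re_le_norm s).trans_lt hs'
  have hbound : ∀ t ∈ Set.Icc (n + x : ℝ) (n + 2),
      ‖-s * ((-s - 1) * (t : ℂ) ^ (-s - 1 - 1))‖ ≤ M := fun t ht ↦ by
    have hpow : t ^ (-s.re - 1 - 1) ≤ x ^ (-5 : ℝ) * (n + 1 : ℝ) ^ (-(3 / 2) : ℝ) := by
      calc t ^ (-s.re - 1 - 1) ≤ (x * (n + 1)) ^ (-s.re - 1 - 1) := by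
            refine Real.rpow_le_rpow_of_nonpos (by positivity) ?_ (by linarith)
            nlinarith [ht.1]
        _ = x ^ (-s.re - 1 - 1) * (n + 1 : ℝ) ^ (-s.re - 1 - 1) :=
            Real.mul_rpow hx0.le (by positivity)
        _ ≤ _ := by
            gcongr ?_ * ?_
            · exact Real.rpow_le_rpow_of_exponent_ge hx0 hx1 (by linarith)
            · exact Real.rpow_le_rpow_of_exponent_le (by linarith) (by linarith)
    rw [norm_mul, norm_mul, norm_neg, Complex.norm_cpow_eq_rpow_re_of_pos (hpos t ht)]
    have h4 : ‖-s - 1‖ ≤ 4 := by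
      refine (norm_sub_le _ _).trans ?_
      rw [norm_neg, norm_one]
      linarith
    simp only [Complex.sub_re, Complex.neg_re, Complex.one_re]
    calc ‖s‖ * (‖-s - 1‖ * t ^ (-s.re - 1 - 1))
        ≤ 3 * (4 * (x ^ (-5 : ℝ) * (n + 1 : ℝ) ^ (-(3 / 2) : ℝ))) := by
          have := Real.rpow_nonneg (hpos t ht).le (-s.re - 1 - 1)
          gcongr
      _ = M := by rw [hM]; ring
  have hM0 : 0 ≤ M := by positivity
  have h₀ : (n + x : ℝ) ∈ Set.Icc (n + x : ℝ) (n + 2) := ⟨le_rfl, by linarith⟩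
  have h₁ : (n + 1 : ℝ) ∈ Set.Icc (n + x : ℝ) (n + 2) := ⟨by linarith, by linarith⟩
  have h₂ : (n + 2 : ℝ) ∈ Set.Icc (n + x : ℝ) (n + 2) := ⟨by linarith, le_rfl⟩
  have hA := norm_sub_sub_smul_deriv_le hf hf' hbound h₀ h₁
  have hB := norm_sub_sub_smul_deriv_le hf hf' hbound h₂ h₁
  set D : ℂ := -s * ((n + 1 : ℝ) : ℂ) ^ (-s - 1)
  have hsplit : hurwitzZetaSubTerm x n s =
      (((n + x : ℝ) : ℂ) ^ (-s) - ((n + 1 : ℝ) : ℂ) ^ (-s) - ((n + x : ℝ) - (n + 1)) • D) +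
      (1 - x : ℝ) •
        (((n + 2 : ℝ) : ℂ) ^ (-s) - ((n + 1 : ℝ) : ℂ) ^ (-s) - ((n + 2 : ℝ) - (n + 1)) • D) := by
    simp only [hurwitzZetaSubTerm, Complex.real_smul]
    push_cast
    ring
  have e1 : |(n + x : ℝ) - (n + 1)| = 1 - x := by rw [abs_of_nonpos] <;> linarith
  have e2 : |(n + 2 : ℝ) - (n + 1)| = 1 := by rw [abs_of_nonneg] <;> linarith
  rw [e1] at hA
  rw [e2] at hB
  rw [hsplit]
  refine (norm_add_le _ _).trans ?_
  rw [norm_smul, Real.norm_of_nonneg (by linarith : 0 ≤ 1 - x)]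
  calc _ ≤ M * (n + 2 - (n + x)) * (1 - x) + (1 - x) * (M * (n + 2 - (n + x)) * 1) := by
        gcongr
    _ = M * (2 * ((2 - x) * (1 - x))) := by ring
    _ ≤ M * 4 := by
        gcongr
        nlinarith
    _ = _ := by rw [hM]; ring

theorem hasDerivAt_hurwitzZetaSubTerm {x : ℝ} (hx : 0 < x) (n : ℕ) (s : ℂ) :
    HasDerivAt (hurwitzZetaSubTerm x n)
      (-(((n + x : ℝ) : ℂ) ^ (-s) * Real.log (n + x)) +
        ((n + 1 : ℝ) : ℂ) ^ (-s) * Real.log (n + 1) +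
        (1 - x) * (((n + 1 : ℝ) : ℂ) ^ (-s) * Real.log (n + 1) -
          ((n + 2 : ℝ) : ℂ) ^ (-s) * Real.log (n + 2))) s := by
  have key : ∀ t : ℝ, 0 < t →
      HasDerivAt (fun s : ℂ ↦ (t : ℂ) ^ (-s)) (-((t : ℂ) ^ (-s) * Real.log t)) s := fun t ht ↦ by
    have h := (hasDerivAt_neg s).const_cpow (c := (t : ℂ))
      (Or.inl (Complex.ofReal_ne_zero.mpr ht.ne'))
    rw [← Complex.ofReal_log ht.le] at h
    simpa using h
  have h₀ := key (n + x) (by positivity)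
  have h₁ := key (n + 1) (by positivity)
  have h₂ := key (n + 2) (by positivity)
  convert! (h₀.sub h₁).sub ((h₁.sub h₂).const_mul (1 - x : ℂ)) using 1
  ring

theorem hasSum_hurwitzZetaSubTerm {x : ℝ} (hx : x ∈ Set.Ioc 0 1) {s : ℂ} (hs : 1 < s.re) :
    HasSum (fun n ↦ hurwitzZetaSubTerm x n s)
      (hurwitzZeta (x : UnitAddCircle) s - hurwitzZeta ((1 : ℝ) : UnitAddCircle) s - (1 - x)) := by
  have h₀ := hasSum_hurwitzZeta_of_one_lt_re (Set.Ioc_subset_Icc_self hx) hs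
  have h₁ := hasSum_hurwitzZeta_of_one_lt_re (a := 1) (by simp) hs
  have h₂ := (hasSum_nat_add_iff' 1).mpr h₁
  convert! (h₀.sub h₁).sub ((h₁.sub h₂).mul_left (1 - x : ℂ)) using 1
  · ext n
    simp only [hurwitzZetaSubTerm, Complex.cpow_neg, one_div]
    push_cast
    rw [show (n : ℂ) + 1 + 1 = n + 2 by ring]
  · simp

theorem sum_range_log_sub (x : ℝ) (N : ℕ) :
    ∑ n ∈ range N, (Real.log (n + 1) + (1 - x) * (Real.log (n + 1) - Real.log (n + 2))) =
      Real.log N.factorial - (1 - x) * Real.log (N + 1) := by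
  induction N with
  | zero => simp
  | succ N ih =>
    rw [sum_range_succ, ih, Nat.factorial_succ]
    push_cast
    rw [Real.log_mul (by positivity) (by positivity), show (N : ℝ) + 1 + 1 = N + 2 by ring]
    ring

theorem tendsto_sum_log_sub {x : ℝ} (hx : 0 < x) :
    Tendsto (fun N : ℕ ↦ ∑ n ∈ range N, (-Real.log (n + x) + Real.log (n + 1) +
      (1 - x) * (Real.log (n + 1) - Real.log (n + 2)))) atTop (𝓝 (Real.log (Real.Gamma x))) := by
  rw [← tendsto_add_atTop_iff_nat 1]
  have hlog := Real.tendsto_log_nat_add_one_sub_log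
  have hlog' := (tendsto_add_atTop_iff_nat 1).mpr hlog
  have h := ((Real.BohrMollerup.tendsto_log_gamma hx).add (hlog.const_mul x)).sub
    (hlog'.const_mul (1 - x))
  simp only [mul_zero, add_zero, sub_zero] at h
  refine h.congr fun N ↦ ?_
  simp only [add_assoc, sum_add_distrib (f := fun n : ℕ ↦ -Real.log (n + x))]
  rw [sum_range_log_sub, Real.BohrMollerup.logGammaSeq, Nat.factorial_succ, sum_neg_distrib]
  simp only [add_comm x]
  push_cast
  rw [Real.log_mul (by positivity) (by positivity)]
  ring

/-- The dependence on `x` in Lerch's formula `ζ'(0, x) = log Γ(x) - log (2π) / 2`. -/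
theorem deriv_hurwitzZeta_zero_sub {x : ℝ} (hx : x ∈ Set.Ioc 0 1) :
    deriv (hurwitzZeta (x : UnitAddCircle)) 0 -
      deriv (hurwitzZeta ((1 : ℝ) : UnitAddCircle)) 0 = Real.log (Real.Gamma x) := by
  set U : Set ℂ := {s | -1 / 2 < s.re} ∩ Metric.ball 0 3 with hUdef
  have hU : IsOpen U := (isOpen_lt continuous_const Complex.continuous_re).inter Metric.isOpen_ball
  have hUconn : IsPreconnected U :=
    ((convex_halfSpace_re_gt _).inter (convex_ball _ _)).isPreconnected
  have h0U : (0 : ℂ) ∈ U := by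
    constructor <;> norm_num
  have h2U : (2 : ℂ) ∈ U := by
    constructor <;> norm_num
  have hsum : Summable fun n : ℕ ↦ 48 * x ^ (-5 : ℝ) * ((n + 1 : ℝ) ^ (-(3 / 2) : ℝ)) := by
    refine Summable.mul_left _ ?_
    simpa using (summable_nat_add_iff 1).mpr
      (Real.summable_nat_rpow.mpr (by norm_num : -(3 / 2 : ℝ) < -1))
  have hdiff : ∀ n, DifferentiableOn ℂ (hurwitzZetaSubTerm x n) U := fun n s _ ↦
    (hasDerivAt_hurwitzZetaSubTerm hx.1 n s).differentiableAt.differentiableWithinAt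
  have hle : ∀ (n : ℕ) (s : ℂ), s ∈ U → ‖hurwitzZetaSubTerm x n s‖ ≤
      48 * x ^ (-5 : ℝ) * ((n + 1 : ℝ) ^ (-(3 / 2) : ℝ)) := fun n s hs ↦
    norm_hurwitzZetaSubTerm_le hx n hs.1 (by simpa using hs.2)
  have hanalytic : AnalyticOnNhd ℂ (fun s ↦ ∑' n, hurwitzZetaSubTerm x n s) U :=
    (Complex.differentiableOn_tsum_of_summable_norm hsum hdiff hU hle).analyticOnNhd hU
  set Z : ℂ → ℂ := fun s ↦
    hurwitzZeta (x : UnitAddCircle) s - hurwitzZeta ((1 : ℝ) : UnitAddCircle) s with hZ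
  have hZanalytic : AnalyticOnNhd ℂ (fun s ↦ Z s - (1 - x)) U :=
    (((differentiable_hurwitzZeta_sub_hurwitzZeta _ _).sub_const _).differentiableOn).analyticOnNhd
      hU
  have heq : Set.EqOn (fun s ↦ ∑' n, hurwitzZetaSubTerm x n s) (fun s ↦ Z s - (1 - x)) U := by
    refine hanalytic.eqOn_of_preconnected_of_eventuallyEq hZanalytic hUconn h2U ?_
    filter_upwards [(isOpen_lt continuous_const Complex.continuous_re).mem_nhds
      (show (1 : ℝ) < (2 : ℂ).re by norm_num)] with s hs
    exact (hasSum_hurwitzZetaSubTerm hx hs).tsum_eq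
  have hderiv : deriv (fun s ↦ ∑' n, hurwitzZetaSubTerm x n s) 0 =
      deriv (hurwitzZeta (x : UnitAddCircle)) 0 -
        deriv (hurwitzZeta ((1 : ℝ) : UnitAddCircle)) 0 := by
    rw [(heq.eventuallyEq_of_mem (hU.mem_nhds h0U)).deriv_eq, deriv_sub_const, hZ,
      deriv_fun_sub (differentiableAt_hurwitzZeta _ zero_ne_one)
        (differentiableAt_hurwitzZeta _ zero_ne_one)]
  have hlim := (Complex.hasSum_deriv_of_summable_norm hsum hdiff hU hle h0U).tendsto_sum_nat
  rw [hderiv] at hlim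
  refine tendsto_nhds_unique hlim ?_
  refine ((Complex.continuous_ofReal.tendsto _).comp (tendsto_sum_log_sub hx.1)).congr fun N ↦ ?_
  simp [(hasDerivAt_hurwitzZetaSubTerm hx.1 _ 0).deriv]

theorem ZMod.deriv_LFunction_zero {N : ℕ} [NeZero N] (Φ : ZMod N → ℂ) :
    deriv (ZMod.LFunction Φ) 0 = -(Real.log N : ℂ) * ZMod.LFunction Φ 0 +
      ∑ j : ZMod N, Φ j * deriv (hurwitzZeta (ZMod.toAddCircle j)) 0 := by
  have hN : (N : ℂ) ≠ 0 := Nat.cast_ne_zero.mpr (NeZero.ne N)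
  have hpow : HasDerivAt (fun s : ℂ ↦ (N : ℂ) ^ (-s)) (-(Real.log N : ℂ)) 0 := by
    simpa using (hasDerivAt_neg (0 : ℂ)).const_cpow (c := (N : ℂ)) (Or.inl hN)
  have hsum : HasDerivAt (fun s ↦ ∑ j : ZMod N, Φ j * hurwitzZeta (ZMod.toAddCircle j) s)
      (∑ j : ZMod N, Φ j * deriv (hurwitzZeta (ZMod.toAddCircle j)) 0) 0 :=
    HasDerivAt.fun_sum fun j _ ↦
      (differentiableAt_hurwitzZeta _ zero_ne_one).hasDerivAt.const_mul _
  have h := (hpow.mul hsum).deriv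
  simp only [neg_zero, Complex.cpow_zero, one_mul] at h
  rw [show ZMod.LFunction Φ 0 = ∑ j : ZMod N, Φ j * hurwitzZeta (ZMod.toAddCircle j) 0 by
    simp [ZMod.LFunction]]
  exact h

theorem ZMod.sum_univ_eq_sum_Icc {M : Type*} [AddCommMonoid M] {q : ℕ} [NeZero q]
    {f : ZMod q → M} (hf : f 0 = 0) :
    ∑ j, f j = ∑ a ∈ Finset.Icc 1 (q - 1), f a := by
  have h0 := NeZero.pos q
  have hrange : ∑ j, f j = ∑ a ∈ range q, f a :=
    sum_nbij' ZMod.val (fun a ↦ (a : ZMod q)) (by simp [ZMod.val_lt]) (by simp) (by simp)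
      (fun a ha ↦ ZMod.val_cast_of_lt (mem_range.mp ha)) (by simp)
  rw [hrange]
  symm
  refine sum_subset (fun a ha ↦ ?_) fun a ha ha' ↦ ?_
  · simp only [Finset.mem_Icc, mem_range] at ha ⊢
    omega
  · simp only [Finset.mem_Icc, mem_range] at ha ha'
    obtain rfl : a = 0 := by omega
    simpa using hf

theorem Lprime_zero_eq (q : ℕ) [NeZero q] (hq : q.Prime) (hodd : Odd q)
    (χ : DirichletCharacter ℂ q) (hχ : χ ≠ 1) (hχodd : χ.Odd) :
    deriv (DirichletCharacter.LFunction χ) 0 =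
      -(Real.log q : ℂ) * DirichletCharacter.LFunction χ 0 +
        ∑ a ∈ Finset.Icc 1 (q - 1),
          χ (a : ZMod q) * (Real.log (Real.Gamma ((a : ℝ) / q)) : ℂ) := by
  have : Fact q.Prime := ⟨hq⟩
  change deriv (ZMod.LFunction χ) 0 = _ * ZMod.LFunction χ 0 + _
  rw [ZMod.deriv_LFunction_zero]
  congr 1
  have hsum : ∑ j : ZMod q, χ j * deriv (hurwitzZeta ((1 : ℝ) : UnitAddCircle)) 0 = 0 := by
    rw [← sum_mul, MulChar.sum_eq_zero_of_ne_one hχ, zero_mul]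
  refine (sub_zero _).symm.trans ?_
  rw [← congrArg₂ (· - ·) rfl hsum, ← sum_sub_distrib,
    ZMod.sum_univ_eq_sum_Icc (by simp [χ.map_nonunit not_isUnit_zero])]
  refine sum_congr rfl fun a ha ↦ ?_
  have hq0 : (0 : ℝ) < q := by exact_mod_cast hq.pos
  obtain ⟨ha1, haq⟩ := Finset.mem_Icc.mp ha
  have hmem : (a / q : ℝ) ∈ Set.Ioc (0 : ℝ) 1 :=
    ⟨div_pos (by exact_mod_cast ha1) hq0,
      (div_le_one hq0).mpr (by exact_mod_cast haq.trans (Nat.sub_le q 1))⟩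
  rw [ZMod.toAddCircle_natCast, ← mul_sub, deriv_hurwitzZeta_zero_sub hmem]
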